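/- arXiv:1904.12464 — 8 statements merged into one kernel-verified Lean document; each statement's English description precedes it below -/
import Mathlib

section
/- Let G be a group, V : G → M_D(ℂ) a map with every V_g unitary, and ω : G × G → ℂ a function such that V_g V_h = ω(g,h) · V_{gh} for all g, h ∈ G (a projective unitary representation). Let Λ be a Hermitian positive-definite D×D matrix with V_g Λ = Λ V_g for all g ∈ G. If there exists NO function ν : G → ℂ with |ν_g| = 1 for all g and ω(g,h) = ν_g ν_h / ν_{gh} for all g, h ∈ G (i.e. ω is not a 2-coboundary), then every eigenvalue of Λ has multiplicity at least two, and consequently every eigenvalue of the Kronecker product Λ ⊗ Λ has multiplicity at least four. -/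
open scoped Kronecker ComplexOrder

/-- A family of products of the entries of two linearly independent families of vectors is
linearly independent. -/
lemma LinearIndependent.pi_mul {K m n ι κ : Type*} [Field K] [Fintype ι] [Fintype κ]
    {v : ι → m → K} {w : κ → n → K}
    (hv : LinearIndependent K v) (hw : LinearIndependent K w) :
    LinearIndependent K (fun p : ι × κ ↦ fun q : m × n ↦ v p.1 q.1 * w p.2 q.2) := by
  rw [Fintype.linearIndependent_iff] at hv hw ⊢
  rintro c hc ⟨i, j⟩
  refine hw (fun j ↦ c (i, j)) (funext fun l ↦ ?_) j
  have key := hv (fun i ↦ ∑ j, c (i, j) * w j l) (funext fun k ↦ ?_) i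
  · simpa [Finset.sum_apply] using key
  · have h := congrFun hc (k, l)
    simp only [Finset.sum_apply, Pi.smul_apply, smul_eq_mul, Pi.zero_apply,
      Fintype.sum_prod_type] at h ⊢
    rw [← h]
    refine Finset.sum_congr rfl fun i _ ↦ ?_
    rw [Finset.sum_mul]
    exact Finset.sum_congr rfl fun j _ ↦ by ring

namespace Matrix

variable {K m n : Type*} [Field K] [Fintype m] [Fintype n]

lemma kronecker_mulVec_mul (A : Matrix m m K) (B : Matrix n n K) (v : m → K) (w : n → K) :
    (A ⊗ₖ B) *ᵥ (fun q : m × n ↦ v q.1 * w q.2) =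
      fun q ↦ (A *ᵥ v) q.1 * (B *ᵥ w) q.2 := by
  ext ⟨i, j⟩
  simp only [mulVec, dotProduct, kroneckerMap_apply, Fintype.sum_prod_type, Finset.sum_mul_sum]
  exact Finset.sum_congr rfl fun _ _ ↦ Finset.sum_congr rfl fun _ _ ↦ by ring

variable [DecidableEq m] [DecidableEq n]

/-- The dimensions of eigenspaces are supermultiplicative under Kronecker products. -/
lemma finrank_eigenspace_mul_le_kronecker (A : Matrix m m K) (B : Matrix n n K) (a b : K) :
    Module.finrank K (Module.End.eigenspace (toLin' A) a) *
      Module.finrank K (Module.End.eigenspace (toLin' B) b) ≤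
    Module.finrank K (Module.End.eigenspace (toLin' (A ⊗ₖ B)) (a * b)) := by
  let v := Module.finBasis K (Module.End.eigenspace (toLin' A) a)
  let w := Module.finBasis K (Module.End.eigenspace (toLin' B) b)
  have hv := v.linearIndependent.map' (Submodule.subtype _) (Submodule.ker_subtype _)
  have hw := w.linearIndependent.map' (Submodule.subtype _) (Submodule.ker_subtype _)
  have hvw := hv.pi_mul hw
  have hmem : ∀ p : Fin _ × Fin _, (fun q : m × n ↦ (v p.1 : m → K) q.1 * (w p.2 : n → K) q.2) ∈
      Module.End.eigenspace (toLin' (A ⊗ₖ B)) (a * b) := by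
    intro p
    have h₁ : A *ᵥ (v p.1 : m → K) = a • (v p.1 : m → K) :=
      Module.End.mem_eigenspace_iff.1 (v p.1).2
    have h₂ : B *ᵥ (w p.2 : n → K) = b • (w p.2 : n → K) :=
      Module.End.mem_eigenspace_iff.1 (w p.2).2
    rw [Module.End.mem_eigenspace_iff, toLin'_apply, kronecker_mulVec_mul, h₁, h₂]
    ext q
    simp only [Pi.smul_apply, smul_eq_mul]
    ring
  have h : LinearIndependent K (fun p ↦ (⟨_, hmem p⟩ :
      Module.End.eigenspace (toLin' (A ⊗ₖ B)) (a * b))) :=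
    LinearIndependent.of_comp (Submodule.subtype _) hvw
  simpa using h.fintype_card_le_finrank

/-- Every eigenvalue of `A ⊗ₖ B` is a product of eigenvalues of `A` and `B`. -/
lemma exists_hasEigenvalue_of_kronecker [IsAlgClosed K] {A : Matrix m m K} {B : Matrix n n K}
    {c : K} (hc : Module.End.HasEigenvalue (toLin' (A ⊗ₖ B)) c) (hA : IsUnit A) :
    ∃ a b, Module.End.HasEigenvalue (toLin' A) a ∧ Module.End.HasEigenvalue (toLin' B) b ∧
      c = a * b := by
  set E := Module.End.eigenspace (toLin' (A ⊗ₖ B)) c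
  have hAB : (A ⊗ₖ (1 : Matrix n n K)) * ((1 : Matrix m m K) ⊗ₖ B) = A ⊗ₖ B := by
    rw [← mul_kronecker_mul, mul_one, one_mul]
  have hcom : (A ⊗ₖ B) * (A ⊗ₖ (1 : Matrix n n K)) = (A ⊗ₖ (1 : Matrix n n K)) * (A ⊗ₖ B) := by
    rw [← mul_kronecker_mul, ← mul_kronecker_mul, mul_one, one_mul]
  have hE : ∀ x ∈ E, toLin' (A ⊗ₖ (1 : Matrix n n K)) x ∈ E := by
    intro x hx
    rw [Module.End.mem_eigenspace_iff, toLin'_apply] at hx ⊢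
    rw [toLin'_apply, mulVec_mulVec, hcom, ← mulVec_mulVec, hx, mulVec_smul]
  have : Nontrivial E := Submodule.nontrivial_iff_ne_bot.2 hc
  obtain ⟨a, ha⟩ := Module.End.exists_eigenvalue ((toLin' (A ⊗ₖ (1 : Matrix n n K))).restrict hE)
  obtain ⟨⟨x, hxE⟩, hx⟩ := ha.exists_hasEigenvector
  have hx0 : x ≠ 0 := fun h ↦ hx.2 (Subtype.ext h)
  have hxa : (A ⊗ₖ (1 : Matrix n n K)) *ᵥ x = a • x := congrArg Subtype.val hx.apply_eq_smul
  have hxc : (A ⊗ₖ B) *ᵥ x = c • x := Module.End.mem_eigenspace_iff.1 hxE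
  obtain ⟨⟨i, j⟩, hij⟩ := Function.ne_iff.1 hx0
  have hcol : A *ᵥ (fun k ↦ x (k, j)) = a • fun k ↦ x (k, j) := by
    ext k
    simpa [mulVec, dotProduct, Fintype.sum_prod_type, one_apply] using congrFun hxa (k, j)
  have hcol0 : (fun k ↦ x (k, j)) ≠ 0 := fun h ↦ hij (congrFun h i)
  have ha0 : a ≠ 0 := by
    rintro rfl
    rw [zero_smul] at hcol
    exact hcol0 (mulVec_injective_iff_isUnit.2 hA (hcol.trans (mulVec_zero A).symm))
  have hcom' : (A ⊗ₖ B) = ((1 : Matrix m m K) ⊗ₖ B) * (A ⊗ₖ (1 : Matrix n n K)) := by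
    rw [← mul_kronecker_mul, mul_one, one_mul]
  have hxb : ((1 : Matrix m m K) ⊗ₖ B) *ᵥ x = (a⁻¹ * c) • x := by
    rw [hcom', ← mulVec_mulVec, hxa, mulVec_smul] at hxc
    rw [mul_smul, ← hxc, inv_smul_smul₀ ha0]
  have hrow : B *ᵥ (fun k ↦ x (i, k)) = (a⁻¹ * c) • fun k ↦ x (i, k) := by
    ext k
    simpa [mulVec, dotProduct, Fintype.sum_prod_type, one_apply, mul_assoc] using
      congrFun hxb (i, k)
  refine ⟨a, a⁻¹ * c,
    Module.End.hasEigenvalue_of_hasEigenvector ⟨Module.End.mem_eigenspace_iff.2 hcol, hcol0⟩,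
    Module.End.hasEigenvalue_of_hasEigenvector
      ⟨Module.End.mem_eigenspace_iff.2 hrow, fun h ↦ hij (congrFun h j)⟩, ?_⟩
  rw [mul_inv_cancel_left₀ ha0]

/-- A unitary matrix has eigenvalues of modulus one. -/
lemma norm_eq_one_of_mem_unitaryGroup_of_mulVec_eq_smul {U : Matrix n n ℂ}
    (hU : U ∈ unitaryGroup n ℂ) {v : n → ℂ} (hv : v ≠ 0) {a : ℂ} (h : U *ᵥ v = a • v) :
    ‖a‖ = 1 := by
  have h₁ : star (U *ᵥ v) ⬝ᵥ (U *ᵥ v) = star v ⬝ᵥ v := by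
    rw [star_mulVec, ← dotProduct_mulVec, mulVec_mulVec, ← star_eq_conjTranspose,
      mem_unitaryGroup_iff'.1 hU, one_mulVec]
  have h₂ : star v ⬝ᵥ v ≠ 0 := fun h ↦ hv (dotProduct_star_self_eq_zero.1 h)
  rw [h, star_smul, smul_dotProduct, dotProduct_smul, smul_smul] at h₁
  have h₃ : star a * a = 1 := mul_right_cancel₀ h₂ (by simpa using h₁)
  rw [Complex.star_def, Complex.conj_mul'] at h₃
  have h₄ : ‖a‖ ^ 2 = 1 := by exact_mod_cast h₃
  exact (pow_eq_one_iff_of_nonneg (norm_nonneg a) two_ne_zero).1 h₄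

/-- If the cocycle of a projective unitary representation is not a coboundary, then every
eigenvalue of a matrix commuting with the representation is degenerate. -/
lemma two_le_finrank_eigenspace_of_commute_projective {G : Type*} [Group G]
    {V : G → Matrix n n ℂ} (hV : ∀ g, V g ∈ unitaryGroup n ℂ)
    {ω : G → G → ℂ} (hproj : ∀ g h, V g * V h = ω g h • V (g * h))
    {A : Matrix n n ℂ} (hcomm : ∀ g, V g * A = A * V g)
    (hω : ¬ ∃ ν : G → ℂ, (∀ g, ‖ν g‖ = 1) ∧ ∀ g h, ω g h = ν g * ν h / ν (g * h))
    {a : ℂ} (ha : Module.End.HasEigenvalue (toLin' A) a) :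
    2 ≤ Module.finrank ℂ (Module.End.eigenspace (toLin' A) a) := by
  by_contra! hlt
  obtain ⟨v, hv, hv0⟩ := ha.exists_hasEigenvector
  have hle : Module.finrank ℂ (Module.End.eigenspace (toLin' A) a) ≤ 1 := by omega
  obtain ⟨u, hu⟩ := finrank_le_one_iff.1 hle
  have hspan : ∀ w ∈ Module.End.eigenspace (toLin' A) a, ∃ c : ℂ, w = c • v := by
    intro w hw
    obtain ⟨c, hc⟩ := hu ⟨w, hw⟩
    obtain ⟨d, hd⟩ := hu ⟨v, hv⟩
    have hc' : c • (u : n → ℂ) = w := congrArg Subtype.val hc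
    have hd' : d • (u : n → ℂ) = v := congrArg Subtype.val hd
    have hd0 : d ≠ 0 := by
      rintro rfl
      exact hv0 (by rw [← hd', zero_smul])
    exact ⟨c * d⁻¹, by rw [← hd', ← hc', smul_smul, inv_mul_cancel_right₀ hd0]⟩
  have hAv : A *ᵥ v = a • v := Module.End.mem_eigenspace_iff.1 hv
  have hscalar : ∀ g, ∃ c : ℂ, V g *ᵥ v = c • v := fun g ↦ hspan _ <| by
    rw [Module.End.mem_eigenspace_iff, toLin'_apply, mulVec_mulVec, ← hcomm, ← mulVec_mulVec, hAv,
      mulVec_smul]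
  choose ν hν using hscalar
  have hnorm : ∀ g, ‖ν g‖ = 1 := fun g ↦
    norm_eq_one_of_mem_unitaryGroup_of_mulVec_eq_smul (hV g) hv0 (hν g)
  refine hω ⟨ν, hnorm, fun g h ↦ ?_⟩
  have hne : ν (g * h) ≠ 0 := norm_ne_zero_iff.1 (by rw [hnorm]; exact one_ne_zero)
  have key := congrArg (· *ᵥ v) (hproj g h)
  simp only [← mulVec_mulVec, smul_mulVec, hν, mulVec_smul, smul_smul] at key
  rw [eq_div_iff hne, mul_comm (ν g), smul_left_injective ℂ hv0 key]

end Matrix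

/-- If `V : G → M_D(ℂ)` is a projective unitary representation with cocycle `ω`
(`V_g V_h = ω(g,h) V_{gh}`) that is *not* a 2-coboundary, and `Λ` is a Hermitian
positive-definite matrix commuting with every `V_g`, then every eigenvalue of `Λ` has
multiplicity at least two, and every eigenvalue of `Λ ⊗ Λ` has multiplicity at least four. -/
theorem spt_entanglement_degeneracy (G : Type*) [Group G] (D : ℕ)
    (V : G → Matrix (Fin D) (Fin D) ℂ)
    (hV : ∀ g, V g ∈ Matrix.unitaryGroup (Fin D) ℂ)
    (ω : G → G → ℂ) (hproj : ∀ g h, V g * V h = ω g h • V (g * h))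
    (Λ : Matrix (Fin D) (Fin D) ℂ) (hΛ : Λ.IsHermitian)
    (hpos : Matrix.PosDef Λ)
    (hcomm : ∀ g, V g * Λ = Λ * V g)
    (hnontriv : ¬ ∃ ν : G → ℂ, (∀ g, ‖ν g‖ = 1) ∧ ∀ g h, ω g h = ν g * ν h / ν (g * h)) :
    (∀ lam : ℂ, Module.End.HasEigenvalue (Matrix.toLin' Λ) lam →
      2 ≤ Module.finrank ℂ (Module.End.eigenspace (Matrix.toLin' Λ) lam)) ∧
    (∀ lam : ℂ, Module.End.HasEigenvalue (Matrix.toLin' (Λ ⊗ₖ Λ)) lam →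
      4 ≤ Module.finrank ℂ (Module.End.eigenspace (Matrix.toLin' (Λ ⊗ₖ Λ)) lam)) := by
  have htwo : ∀ lam : ℂ, Module.End.HasEigenvalue (Matrix.toLin' Λ) lam →
      2 ≤ Module.finrank ℂ (Module.End.eigenspace (Matrix.toLin' Λ) lam) := fun _ h ↦
    Matrix.two_le_finrank_eigenspace_of_commute_projective hV hproj hcomm hnontriv h
  refine ⟨htwo, fun lam h ↦ ?_⟩
  obtain ⟨a, b, ha, hb, rfl⟩ := Matrix.exists_hasEigenvalue_of_kronecker h hpos.isUnit
  exact (Nat.mul_le_mul (htwo a ha) (htwo b hb)).trans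
    (Matrix.finrank_eigenspace_mul_le_kronecker Λ Λ a b)
end

section
/- Let G be a group, V : G → M_D(ℂ) with every V_g unitary, and ω : G × G → ℂ with V_g V_h = ω(g,h) · V_{gh} for all g, h ∈ G. Let Λ be a Hermitian D×D matrix commuting with V_g for every g ∈ G, and suppose Λ has an eigenvalue λ whose eigenspace is one-dimensional. Then there exists ν : G → ℂ with |ν_g| = 1 for all g ∈ G and ω(g,h) = ν_g ν_h / ν_{gh} for all g, h ∈ G. -/
open Matrix in
open scoped ComplexOrder in
theorem norm_eq_one_of_mem_unitaryGroup_of_mulVec_eq_smul {n : Type*} [Fintype n] [DecidableEq n]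
    {U : Matrix n n ℂ} (hU : U ∈ Matrix.unitaryGroup n ℂ) {v : n → ℂ} (hv : v ≠ 0) {c : ℂ}
    (h : U *ᵥ v = c • v) : ‖c‖ = 1 := by
  have hinner : star (U *ᵥ v) ⬝ᵥ (U *ᵥ v) = star v ⬝ᵥ v := by
    rw [star_mulVec, ← dotProduct_mulVec, mulVec_mulVec, ← star_eq_conjTranspose,
      Matrix.mem_unitaryGroup_iff'.mp hU, one_mulVec]
  have hv' : star v ⬝ᵥ v ≠ 0 := dotProduct_star_self_eq_zero.not.mpr hv
  rw [h, star_smul, smul_dotProduct, dotProduct_smul, smul_smul, smul_eq_mul] at hinner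
  have hc : star c * c = 1 := mul_right_cancel₀ hv' (hinner.trans (one_mul _).symm)
  have hsq : ‖c‖ * ‖c‖ = 1 := by simpa using congrArg norm hc
  nlinarith [norm_nonneg c]

open Matrix in
theorem exists_smul_of_commute_of_finrank_eigenspace_eq_one {K n : Type*} [Field K] [Fintype n]
    [DecidableEq n] {A B : Matrix n n K} (hAB : Commute A B) {μ : K}
    (hdim : Module.finrank K (Module.End.eigenspace (Matrix.toLin' B) μ) = 1) {v : n → K}
    (hv : Module.End.HasEigenvector (Matrix.toLin' B) μ v) : ∃ c : K, A *ᵥ v = c • v := by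
  have hmem : A *ᵥ v ∈ Module.End.eigenspace (Matrix.toLin' B) μ := by
    have hBv : B *ᵥ v = μ • v := by simpa using hv.apply_eq_smul
    rw [Module.End.mem_eigenspace_iff, toLin'_apply, mulVec_mulVec, ← hAB.eq, ← mulVec_mulVec,
      hBv, mulVec_smul]
  have hne : (⟨v, hv.1⟩ : Module.End.eigenspace (Matrix.toLin' B) μ) ≠ 0 :=
    fun h => hv.2 (congrArg Subtype.val h)
  obtain ⟨c, hc⟩ := (finrank_eq_one_iff_of_nonzero' _ hne).mp hdim ⟨_, hmem⟩
  exact ⟨c, (congrArg Subtype.val hc).symm⟩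

/-- If `V : G → M_D(ℂ)` is a projective unitary representation with cocycle `ω`
(`V_g V_h = ω(g,h) V_{gh}`), and `Λ` is a Hermitian matrix commuting with every `V_g`
that possesses an eigenvalue `λ` with a one-dimensional eigenspace, then `ω` is a
2-coboundary: there is a unimodular `ν : G → ℂ` with `ω(g,h) = ν_g ν_h / ν_{gh}`. -/
theorem coboundary_of_nondegenerate_eigenvalue (G : Type*) [Group G] (D : ℕ)
    (V : G → Matrix (Fin D) (Fin D) ℂ)
    (hV : ∀ g, V g ∈ Matrix.unitaryGroup (Fin D) ℂ)
    (ω : G → G → ℂ) (hproj : ∀ g h, V g * V h = ω g h • V (g * h))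
    (Λ : Matrix (Fin D) (Fin D) ℂ) (hΛ : Λ.IsHermitian)
    (hcomm : ∀ g, V g * Λ = Λ * V g)
    (lam : ℂ) (hlam : Module.End.HasEigenvalue (Matrix.toLin' Λ) lam)
    (hdim : Module.finrank ℂ (Module.End.eigenspace (Matrix.toLin' Λ) lam) = 1) :
    ∃ ν : G → ℂ, (∀ g, ‖ν g‖ = 1) ∧ ∀ g h, ω g h = ν g * ν h / ν (g * h) := by
  obtain ⟨v, hv⟩ := hlam.exists_hasEigenvector
  choose ν hν using fun g =>
    exists_smul_of_commute_of_finrank_eigenspace_eq_one (hcomm g) hdim hv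
  have hnorm g : ‖ν g‖ = 1 :=
    norm_eq_one_of_mem_unitaryGroup_of_mulVec_eq_smul (hV g) hv.2 (hν g)
  refine ⟨ν, hnorm, fun g h => ?_⟩
  have hne : ν (g * h) ≠ 0 := norm_ne_zero_iff.mp (by simp [hnorm])
  rw [eq_div_iff hne]
  have key := congrArg (fun M => Matrix.mulVec M v) (hproj g h)
  simp only [← Matrix.mulVec_mulVec, Matrix.smul_mulVec, hν, Matrix.mulVec_smul, smul_smul] at key
  rw [mul_comm (ν g), smul_left_injective ℂ hv.2 key]
end

section
/- Let R_d and R_o be real skew-symmetric n×n matrices satisfying R_d² + R_o² = −I and R_d R_o + R_o R_d = 0. Let ε ∈ ℝ with |ε| < 1 and let φ ∈ ℂⁿ be a unit vector with (i R_d) φ = ε φ. Then φ̃ := (1−ε²)^{-1/2} · R_o · conj(φ) (with conj the entrywise complex conjugate) is a unit vector satisfying (i R_d) φ̃ = ε φ̃ and ⟨φ, φ̃⟩ = 0. In particular, every eigenvalue of the Hermitian matrix i R_d lying in the open interval (−1,1) has multiplicity at least two. -/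
open scoped Matrix

namespace Matrix

variable {n : Type*} [Fintype n]

theorem star_map_ofReal_mulVec (R : Matrix n n ℝ) (v : n → ℂ) :
    star (R.map Complex.ofReal *ᵥ v) = R.map Complex.ofReal *ᵥ star v := by
  ext i
  simp [mulVec, dotProduct]

theorem map_ofReal_mul (R S : Matrix n n ℝ) :
    (R * S).map Complex.ofReal = R.map Complex.ofReal * S.map Complex.ofReal :=
  Matrix.map_mul (f := Complex.ofRealHom)

theorem transpose_map_ofReal_of_skew {m : Type*} {R : Matrix m m ℝ} (hR : Rᵀ = -R) :
    (R.map Complex.ofReal)ᵀ = -R.map Complex.ofReal := by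
  rw [← transpose_map, hR]
  ext i j
  simp

theorem dotProduct_mulVec_of_skew {A : Matrix n n ℂ} (hA : Aᵀ = -A) (v w : n → ℂ) :
    v ⬝ᵥ A *ᵥ w = -((A *ᵥ v) ⬝ᵥ w) := by
  rw [dotProduct_mulVec, ← mulVec_transpose, hA, neg_mulVec, neg_dotProduct]

theorem dotProduct_mulVec_self_of_skew {A : Matrix n n ℂ} (hA : Aᵀ = -A) (v : n → ℂ) :
    v ⬝ᵥ A *ᵥ v = 0 := by
  have h := dotProduct_mulVec_of_skew hA v v
  rw [dotProduct_comm (A *ᵥ v)] at h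
  exact self_eq_neg.mp h

theorem star_dotProduct_self_eq_sum (v : n → ℂ) :
    star v ⬝ᵥ v = ((∑ i, ‖v i‖ ^ 2 : ℝ) : ℂ) := by
  simp [dotProduct, Complex.conj_mul']

/-- If `Rd` and `Ro` anticommute, the antilinear map `v ↦ Ro (star v)` preserves the
eigenspaces of `i Rd`. -/
theorem I_smul_mulVec_mulVec_star {Rd Ro : Matrix n n ℝ} (hanti : Rd * Ro + Ro * Rd = 0)
    {μ : ℝ} {v : n → ℂ} (hv : (Complex.I • Rd.map Complex.ofReal) *ᵥ v = (μ : ℂ) • v) :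
    (Complex.I • Rd.map Complex.ofReal) *ᵥ (Ro.map Complex.ofReal *ᵥ star v) =
      (μ : ℂ) • (Ro.map Complex.ofReal *ᵥ star v) := by
  have hstar : Complex.I • (Rd.map Complex.ofReal *ᵥ star v) = -((μ : ℂ) • star v) := by
    have h := congrArg star hv
    rw [smul_mulVec, star_smul, star_smul, star_map_ofReal_mulVec] at h
    simpa [neg_eq_iff_eq_neg] using h
  have hcomm : Rd.map Complex.ofReal * Ro.map Complex.ofReal =
      -(Ro.map Complex.ofReal * Rd.map Complex.ofReal) := by
    rw [← map_ofReal_mul, ← map_ofReal_mul, eq_neg_of_add_eq_zero_left hanti]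
    ext i j
    simp
  rw [smul_mulVec, mulVec_mulVec, hcomm, neg_mulVec, ← mulVec_mulVec, smul_neg, ← mulVec_smul,
    hstar, mulVec_neg, neg_neg, mulVec_smul]

theorem star_dotProduct_self_mulVec_star [DecidableEq n] {Rd Ro : Matrix n n ℝ}
    (hRo : Roᵀ = -Ro) (hsq : Rd * Rd + Ro * Ro = -1)
    {μ : ℝ} {v : n → ℂ} (hv : (Complex.I • Rd.map Complex.ofReal) *ᵥ v = (μ : ℂ) • v) :
    star (Ro.map Complex.ofReal *ᵥ star v) ⬝ᵥ (Ro.map Complex.ofReal *ᵥ star v) =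
      (1 - (μ : ℂ) ^ 2) * (star v ⬝ᵥ v) := by
  have hA : Rd.map Complex.ofReal *ᵥ v = (-Complex.I * μ) • v := by
    rw [mul_smul, ← hv, smul_mulVec, smul_smul]
    simp
  have hB : Ro.map Complex.ofReal * Ro.map Complex.ofReal =
      -1 - Rd.map Complex.ofReal * Rd.map Complex.ofReal := by
    rw [← map_ofReal_mul, ← map_ofReal_mul, eq_sub_of_add_eq' hsq]
    ext i j
    by_cases h : i = j <;> simp [h]
  have hBB : Ro.map Complex.ofReal *ᵥ (Ro.map Complex.ofReal *ᵥ v) = -((1 - (μ : ℂ) ^ 2) • v) := by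
    rw [mulVec_mulVec, hB, sub_mulVec, ← mulVec_mulVec, hA, mulVec_smul, hA, smul_smul, neg_mulVec,
      one_mulVec, sub_smul, one_smul]
    have : -Complex.I * μ * (-Complex.I * μ) = -(μ : ℂ) ^ 2 := by
      linear_combination (μ : ℂ) ^ 2 * Complex.I_sq
    rw [this, neg_smul]
    abel
  rw [dotProduct_mulVec_of_skew (transpose_map_ofReal_of_skew hRo), star_map_ofReal_mulVec,
    star_star, hBB, neg_dotProduct, neg_neg, smul_dotProduct, smul_eq_mul, dotProduct_comm v]

theorem star_dotProduct_mulVec_star {Ro : Matrix n n ℝ} (hRo : Roᵀ = -Ro) (v : n → ℂ) :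
    star v ⬝ᵥ (Ro.map Complex.ofReal *ᵥ star v) = 0 :=
  dotProduct_mulVec_self_of_skew (transpose_map_ofReal_of_skew hRo) _

theorem linearIndependent_pair_of_star_dotProduct_eq_zero {v w : n → ℂ}
    (hv : star v ⬝ᵥ v ≠ 0) (hw : w ≠ 0) (hvw : star v ⬝ᵥ w = 0) :
    LinearIndependent ℂ ![v, w] := by
  rw [LinearIndependent.pair_iff]
  intro s t h
  have hs : s = 0 := by
    have h' := congrArg (star v ⬝ᵥ ·) h
    simpa [dotProduct_add, dotProduct_smul, hvw, hv] using h'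
  subst hs
  simpa [hw] using h

theorem two_le_finrank_eigenspace_I_smul [DecidableEq n] {Rd Ro : Matrix n n ℝ}
    (hRo : Roᵀ = -Ro) (hsq : Rd * Rd + Ro * Ro = -1) (hanti : Rd * Ro + Ro * Rd = 0)
    {μ : ℝ} (hμ : μ ^ 2 < 1)
    (h : Module.End.HasEigenvalue (toLin' (Complex.I • Rd.map Complex.ofReal)) (μ : ℂ)) :
    2 ≤ Module.finrank ℂ
      (Module.End.eigenspace (toLin' (Complex.I • Rd.map Complex.ofReal)) (μ : ℂ)) := by
  obtain ⟨v, hv⟩ := h.exists_hasEigenvector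
  have hveig : (Complex.I • Rd.map Complex.ofReal) *ᵥ v = (μ : ℂ) • v := by
    simpa only [toLin'_apply] using hv.apply_eq_smul
  have hvv : star v ⬝ᵥ v ≠ 0 := by
    rw [star_dotProduct_self_eq_sum, Complex.ofReal_ne_zero]
    intro h0
    rw [Finset.sum_eq_zero_iff_of_nonneg fun _ _ => by positivity] at h0
    exact hv.2 (funext fun i => by simpa using h0 i (Finset.mem_univ i))
  have hw : Ro.map Complex.ofReal *ᵥ star v ≠ 0 := by
    intro h0
    have h1 := star_dotProduct_self_mulVec_star hRo hsq hveig
    rw [h0, dotProduct_zero, eq_comm, mul_eq_zero] at h1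
    have h2 := h1.resolve_right hvv
    norm_cast at h2
    linarith
  have hli := linearIndependent_pair_of_star_dotProduct_eq_zero hvv hw
    (star_dotProduct_mulVec_star hRo v)
  have hspan : Submodule.span ℂ (Set.range ![v, Ro.map Complex.ofReal *ᵥ star v]) ≤
      Module.End.eigenspace (toLin' (Complex.I • Rd.map Complex.ofReal)) (μ : ℂ) := by
    rw [Submodule.span_le, Set.range_subset_iff, Fin.forall_fin_two]
    refine ⟨hv.1, ?_⟩
    simpa only [SetLike.mem_coe, Module.End.mem_eigenspace_iff, toLin'_apply,
      cons_val_one, cons_val_fin_one] using I_smul_mulVec_mulVec_star hanti hveig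
  simpa [finrank_span_eq_card hli] using Submodule.finrank_mono hspan

end Matrix

/-- Degeneracy mechanism for a symmetric bipartition (Sec. IV.A of the paper). If `R_d`,
`R_o` are real skew-symmetric with `R_d² + R_o² = -I` and `{R_d, R_o} = 0`, and `φ` is a
unit eigenvector of `i R_d` with eigenvalue `ε ∈ (-1,1)`, then
`φ̃ = (1-ε²)^{-1/2} R_o conj(φ)` is a unit eigenvector with the same eigenvalue, orthogonal
to `φ`; in particular every eigenvalue of `i R_d` in `(-1,1)` is at least doubly degenerate. -/
theorem skew_pair_eigen_degeneracy (n : ℕ) (Rd Ro : Matrix (Fin n) (Fin n) ℝ)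
    (hRd : Rdᵀ = -Rd) (hRo : Roᵀ = -Ro)
    (hsq : Rd * Rd + Ro * Ro = -1)
    (hanti : Rd * Ro + Ro * Rd = 0)
    (ε : ℝ) (hε : |ε| < 1)
    (φ : Fin n → ℂ) (hφnorm : ∑ i, ‖φ i‖ ^ 2 = 1)
    (hφeig : (Complex.I • (Rd.map (Complex.ofReal))).mulVec φ = (ε : ℂ) • φ)
    (φt : Fin n → ℂ)
    (hφt : φt = (↑(Real.sqrt (1 - ε ^ 2))⁻¹ : ℂ) • (Ro.map (Complex.ofReal)).mulVec (star φ)) :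
    (∑ i, ‖φt i‖ ^ 2 = 1) ∧
    ((Complex.I • (Rd.map (Complex.ofReal))).mulVec φt = (ε : ℂ) • φt) ∧
    (star φ ⬝ᵥ φt = 0) ∧
    (∀ μ : ℝ, -1 < μ → μ < 1 →
      Module.End.HasEigenvalue (Matrix.toLin' (Complex.I • (Rd.map (Complex.ofReal)))) (μ : ℂ) →
      2 ≤ Module.finrank ℂ
        (Module.End.eigenspace (Matrix.toLin' (Complex.I • (Rd.map (Complex.ofReal)))) (μ : ℂ))) := by
  have hpos : 0 < 1 - ε ^ 2 := by
    have := (sq_lt_one_iff_abs_lt_one ε).mpr hε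
    linarith
  subst hφt
  refine ⟨?_, ?_, ?_, fun μ h₁ h₂ h => ?_⟩
  · rw [← Complex.ofReal_inj, ← Matrix.star_dotProduct_self_eq_sum, star_smul, smul_dotProduct,
      dotProduct_smul, Matrix.star_dotProduct_self_mulVec_star hRo hsq hφeig,
      Matrix.star_dotProduct_self_eq_sum, hφnorm]
    simp only [Complex.star_def, Complex.conj_ofReal, smul_eq_mul]
    norm_cast
    rw [mul_one, ← mul_assoc, ← mul_inv, Real.mul_self_sqrt hpos.le, inv_mul_cancel₀ hpos.ne']
  · rw [Matrix.mulVec_smul, Matrix.I_smul_mulVec_mulVec_star hanti hφeig, smul_comm]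
  · rw [dotProduct_smul, Matrix.star_dotProduct_mulVec_star hRo, smul_zero]
  · exact Matrix.two_le_finrank_eigenspace_I_smul hRo hsq hanti (by nlinarith) h
end

section
/- For N ≥ 1 and t ∈ ℝ, let E_N(t) be the N×N complex matrix with all diagonal entries equal to 1/2, entries [E_N(t)]_{1,2} = −(i/2)·sin t and [E_N(t)]_{2,1} = (i/2)·sin t, entries [E_N(t)]_{j,j+1} = −(i/2)·sin t·cos t and [E_N(t)]_{j+1,j} = (i/2)·sin t·cos t for 2 ≤ j ≤ N−1, and all other entries zero. Then for every odd N and every t ∈ ℝ, det( (1/2)·I_N − E_N(t) ) = 0; i.e., 1/2 is an eigenvalue of E_N(t) at all times t. -/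
/-- A skew-symmetric matrix of odd size over a domain of characteristic zero is singular. -/
theorem Matrix.det_eq_zero_of_transpose_eq_neg {n R : Type*} [Fintype n] [DecidableEq n]
    [CommRing R] [IsDomain R] [CharZero R] {A : Matrix n n R} (hA : A.transpose = -A)
    (hn : Odd (Fintype.card n)) : A.det = 0 := by
  have h : A.det = -A.det := by
    conv_lhs => rw [← Matrix.det_transpose, hA, Matrix.det_neg, hn.neg_one_pow, neg_one_mul]
  exact self_eq_neg.mp h

/-- Flat-band model (Sec. V.A.1 / Appendix I.1 of the paper): for the tridiagonal matrix
`E_N(t)` with diagonal `1/2`, first off-diagonal entries `∓(i/2) sin t`, and remaining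
off-diagonal entries `∓(i/2) sin t cos t`, the value `1/2` is an eigenvalue at all times
`t` whenever `N` is odd. -/
theorem flat_band_half_eigenvalue_odd (N : ℕ) (hN : Odd N) (t : ℝ)
    (E : Matrix (Fin N) (Fin N) ℂ)
    (hE : ∀ i j : Fin N, E i j =
      if i = j then 1 / 2
      else if (i : ℕ) + 1 = (j : ℕ) then
        (if (i : ℕ) = 0 then -(Complex.I / 2) * Real.sin t
         else -(Complex.I / 2) * Real.sin t * Real.cos t)
      else if (j : ℕ) + 1 = (i : ℕ) then
        (if (j : ℕ) = 0 then (Complex.I / 2) * Real.sin t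
         else (Complex.I / 2) * Real.sin t * Real.cos t)
      else 0) :
    Matrix.det ((1 / 2 : ℂ) • (1 : Matrix (Fin N) (Fin N) ℂ) - E) = 0 := by
  refine Matrix.det_eq_zero_of_transpose_eq_neg ?_ (by simpa using hN)
  ext i j
  simp only [Matrix.transpose_apply, Matrix.neg_apply, Matrix.sub_apply, Matrix.smul_apply,
    Matrix.one_apply, hE, Fin.ext_iff, smul_eq_mul]
  split_ifs <;> first | omega | ring
end

section
/- For N ≥ 1 and t ∈ ℝ, let E_N(t) be the N×N complex matrix with all diagonal entries equal to 1/2, entries [E_N(t)]_{1,2} = −(i/2)·sin t and [E_N(t)]_{2,1} = (i/2)·sin t, entries [E_N(t)]_{j,j+1} = −(i/2)·sin t·cos t and [E_N(t)]_{j+1,j} = (i/2)·sin t·cos t for 2 ≤ j ≤ N−1, and all other entries zero. Then for every even N = 2n with n ≥ 1 and every t ∈ ℝ, det( (1/2)·I_N − E_N(t) ) = (−1)^n · 4^{−n} · (sin t)^{2n} · (cos t)^{2n−2}. -/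
open Matrix in
/-- Expanding a tridiagonal matrix with vanishing diagonal along its first row and column removes
two rows and columns. -/
theorem Matrix.det_hollow_tridiagonal_add_two {R : Type*} [CommRing R] (m : ℕ) (a b : ℕ → R) :
    det (of fun i j : Fin (m + 2) =>
      if (i : ℕ) + 1 = j then a i else if (j : ℕ) + 1 = i then b j else 0) =
    -(a 0 * b 0) * det (of fun i j : Fin m =>
      if (i : ℕ) + 1 = j then a (i + 2) else if (j : ℕ) + 1 = i then b (j + 2) else 0) := by
  rw [det_succ_row_zero, Fin.sum_univ_succ, Fin.sum_univ_succ, det_succ_column_zero (n := m),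
    det_succ_column_zero (n := m), Fin.sum_univ_succ, Fin.sum_univ_succ]
  have hsub : ((of fun i j : Fin (m + 2) =>
      if (i : ℕ) + 1 = j then a i else if (j : ℕ) + 1 = i then b j else 0).submatrix
        Fin.succ (Fin.succAbove (Fin.succ 0))).submatrix (Fin.succAbove 0) Fin.succ =
      of fun i j : Fin m =>
        if (i : ℕ) + 1 = j then a (i + 2) else if (j : ℕ) + 1 = i then b (j + 2) else 0 := by
    ext i j
    simp [add_assoc]
  rw [hsub]
  simp [mul_assoc]

open Matrix in
/-- The determinant of a tridiagonal matrix of even size with vanishing diagonal. -/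
theorem Matrix.det_hollow_tridiagonal_even {R : Type*} [CommRing R] (n : ℕ) (a b : ℕ → R) :
    det (of fun i j : Fin (2 * n) =>
      if (i : ℕ) + 1 = j then a i else if (j : ℕ) + 1 = i then b j else 0) =
    ∏ k ∈ Finset.range n, -(a (2 * k) * b (2 * k)) := by
  induction n generalizing a b with
  | zero => simp
  | succ n ih =>
    rw [Finset.prod_range_succ', mul_comm (∏ _ ∈ _, _)]
    exact (det_hollow_tridiagonal_add_two (2 * n) a b).trans
      (congrArg _ (ih (fun k => a (k + 2)) fun k => b (k + 2)))

/-- Flat-band model (Sec. V.A.1 / Appendix I.1 of the paper): for the tridiagonal matrix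
`E_N(t)` with diagonal `1/2`, first off-diagonal entries `∓(i/2) sin t`, and remaining
off-diagonal entries `∓(i/2) sin t cos t`, for even `N = 2n` the characteristic
determinant at `1/2` equals `(-1)^n 4^{-n} (sin t)^{2n} (cos t)^{2n-2}`. -/
theorem flat_band_half_det_even (N n : ℕ) (hn : 1 ≤ n) (hN : N = 2 * n) (t : ℝ)
    (E : Matrix (Fin N) (Fin N) ℂ)
    (hE : ∀ i j : Fin N, E i j =
      if i = j then 1 / 2
      else if (i : ℕ) + 1 = (j : ℕ) then
        (if (i : ℕ) = 0 then -(Complex.I / 2) * Real.sin t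
         else -(Complex.I / 2) * Real.sin t * Real.cos t)
      else if (j : ℕ) + 1 = (i : ℕ) then
        (if (j : ℕ) = 0 then (Complex.I / 2) * Real.sin t
         else (Complex.I / 2) * Real.sin t * Real.cos t)
      else 0) :
    Matrix.det ((1 / 2 : ℂ) • (1 : Matrix (Fin N) (Fin N) ℂ) - E) =
      (-1 : ℂ) ^ n * ((4 : ℂ)⁻¹) ^ n * (Real.sin t : ℂ) ^ (2 * n) *
        (Real.cos t : ℂ) ^ (2 * n - 2) := by
  subst hN
  obtain ⟨m, rfl⟩ := Nat.exists_eq_add_of_le' hn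
  set c : ℕ → ℂ := fun k => Complex.I / 2 * Real.sin t * if k = 0 then 1 else (Real.cos t : ℂ)
    with hc
  have hM : (1 / 2 : ℂ) • (1 : Matrix (Fin (2 * (m + 1))) (Fin (2 * (m + 1))) ℂ) - E =
      Matrix.of fun i j : Fin (2 * (m + 1)) =>
        if (i : ℕ) + 1 = j then c i else if (j : ℕ) + 1 = i then -c j else 0 := by
    ext i j
    rw [Matrix.sub_apply, hE, Matrix.smul_apply, Matrix.one_apply, Matrix.of_apply]
    by_cases hij : i = j
    · simp [hij]
    · simp only [hij, if_false, hc]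
      split_ifs <;> simp
  have hsq : (-(c 0 * -c 0) : ℂ) = -1 * 4⁻¹ * (Real.sin t : ℂ) ^ 2 := by
    simp only [hc, if_true]
    linear_combination (Real.sin t : ℂ) ^ 2 / 4 * Complex.I_sq
  have hsq' (k : ℕ) : (-(c (2 * (k + 1)) * -c (2 * (k + 1))) : ℂ) =
      -1 * 4⁻¹ * (Real.sin t : ℂ) ^ 2 * (Real.cos t : ℂ) ^ 2 := by
    have hk : 2 * (k + 1) ≠ 0 := by omega
    simp only [hc, if_neg hk]
    linear_combination (Real.sin t : ℂ) ^ 2 * (Real.cos t : ℂ) ^ 2 / 4 * Complex.I_sq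
  rw [hM, Matrix.det_hollow_tridiagonal_even (m + 1) c fun k => -c k,
    Finset.prod_range_succ', mul_zero, hsq,
    Finset.prod_congr rfl fun k _ => hsq' k, Finset.prod_const, Finset.card_range,
    show 2 * (m + 1) - 2 = 2 * m by omega]
  simp only [mul_pow, pow_mul, pow_succ _ m]
  ring
end

section
/- For all real numbers κ₁ > κ₂ > 0 and every nonzero integer n: ∫_{-∞}^{∞} e^{-i n k} · sin(π κ₂/κ₁) / ( 2 κ₂ · ( cosh(π k/κ₁) + cos(π κ₂/κ₁) ) ) dk = (κ₁/κ₂) · sinh(n κ₂) / sinh(n κ₁). -/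
open scoped Real

open Complex MeasureTheory Filter Topology

theorem Real.one_add_sq_div_two_le_cosh (t : ℝ) : 1 + t ^ 2 / 2 ≤ Real.cosh t := by
  have h : Real.cosh t = 1 + 2 * Real.sinh (t / 2) ^ 2 := by
    rw [← mul_div_cancel₀ t (two_ne_zero (α := ℝ)), Real.cosh_two_mul, Real.cosh_sq]
    ring_nf
  have h1 : (t / 2) ^ 2 ≤ Real.sinh (t / 2) ^ 2 := by
    rw [sq_le_sq, Real.abs_sinh]
    exact Real.self_le_sinh_iff.2 (abs_nonneg _)
  linarith

theorem Real.integrable_inv_cosh_add {c : ℝ} (hc : -1 < c) :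
    Integrable fun t : ℝ => (Real.cosh t + c)⁻¹ := by
  have hpos (t : ℝ) : 0 < Real.cosh t + c := by linarith [Real.one_le_cosh t]
  set δ := min (1 + c) (1 / 2)
  have hδ : 0 < δ := lt_min (by linarith) (by norm_num)
  refine (integrable_inv_one_add_sq.const_mul δ⁻¹).mono' ?_ (.of_forall fun t => ?_)
  · exact ((Real.continuous_cosh.add continuous_const).inv₀
      fun t => (hpos t).ne').aestronglyMeasurable
  · rw [Real.norm_of_nonneg (inv_nonneg.2 (hpos t).le), ← mul_inv]
    refine inv_anti₀ (by positivity) ?_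
    have h1 : δ ≤ 1 + c := min_le_left _ _
    have h2 : δ ≤ 1 / 2 := min_le_right _ _
    nlinarith [Real.one_add_sq_div_two_le_cosh t, sq_nonneg t]

theorem Complex.normSq_cosh_add_one (x y : ℝ) :
    normSq (cosh (x + y * I) + 1) = (Real.cosh x + Real.cos y) ^ 2 := by
  have h : cosh (x + y * I) + 1 =
      (Real.cosh x * Real.cos y + 1 : ℝ) + (Real.sinh x * Real.sin y : ℝ) * I := by
    rw [cosh_add, cosh_mul_I, sinh_mul_I]
    push_cast
    ring
  rw [h, normSq_add_mul_I]
  linear_combination (-Real.sin y ^ 2) * Real.cosh_sq x +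
    (Real.cosh x ^ 2 - 1) * Real.sin_sq_add_cos_sq y

theorem Complex.norm_cosh_add_one (x y : ℝ) :
    ‖cosh (x + y * I) + 1‖ = Real.cosh x + Real.cos y := by
  rw [norm_def, normSq_cosh_add_one, Real.sqrt_sq]
  linarith [Real.one_le_cosh x, Real.neg_one_le_cos y]

theorem Real.neg_one_lt_cos_of_abs_lt_pi {y : ℝ} (hy : |y| < π) : -1 < Real.cos y := by
  rw [← Real.cos_abs, ← Real.cos_pi]
  exact Real.cos_lt_cos_of_nonneg_of_le_pi (abs_nonneg y) le_rfl hy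

theorem Complex.cosh_add_one_ne_zero {x y : ℝ} (hy : |y| < π) : cosh (x + y * I) + 1 ≠ 0 := by
  rw [← norm_pos_iff, norm_cosh_add_one]
  linarith [Real.one_le_cosh x, Real.neg_one_lt_cos_of_abs_lt_pi hy]

theorem norm_cexp_div_cosh_add_one (ω x y : ℝ) :
    ‖cexp (-(I * ω * (x + y * I))) / (cosh (x + y * I) + 1)‖ =
      Real.exp (ω * y) * (Real.cosh x + Real.cos y)⁻¹ := by
  rw [norm_div, norm_cosh_add_one, norm_exp, div_eq_mul_inv]
  simp

theorem integrable_cexp_div_cosh_add_one (ω : ℝ) {y : ℝ} (hy : |y| < π) :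
    Integrable fun x : ℝ => cexp (-(I * ω * (x + y * I))) / (cosh (x + y * I) + 1) := by
  refine ((Real.integrable_inv_cosh_add (Real.neg_one_lt_cos_of_abs_lt_pi hy)).const_mul
    (Real.exp (ω * y))).mono' ?_ (.of_forall fun x => (norm_cexp_div_cosh_add_one ω x y).le)
  refine (Continuous.div (by fun_prop) ?_ fun x => cosh_add_one_ne_zero hy).aestronglyMeasurable
  exact (continuous_cosh.comp (by fun_prop)).add continuous_const

theorem tendsto_integral_vertical_cexp_div_cosh_add_one (ω a : ℝ) {l : Filter ℝ} {u : ℝ → ℝ}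
    (hu : Tendsto (fun R => u R ^ 2) l atTop) :
    Tendsto (fun R => ∫ y : ℝ in (0 : ℝ)..a,
      cexp (-(I * ω * (u R + y * I))) / (cosh (u R + y * I) + 1)) l (𝓝 0) := by
  have hlim : Tendsto (fun R => Real.exp (|ω| * |a|) * (u R ^ 2 / 2)⁻¹ * |a - 0|) l (𝓝 0) := by
    have h := (tendsto_inv_atTop_zero.comp (hu.atTop_div_const (zero_lt_two (α := ℝ))))
    simpa using (h.const_mul (Real.exp (|ω| * |a|))).mul_const |a - 0|
  refine squeeze_zero_norm' ?_ hlim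
  filter_upwards [hu.eventually_gt_atTop 0] with R hR
  refine intervalIntegral.norm_integral_le_of_norm_le_const fun y hy => ?_
  rw [norm_cexp_div_cosh_add_one]
  have hya : |y| ≤ |a| := by
    simpa using Set.abs_sub_left_of_mem_uIcc (Set.uIoc_subset_uIcc hy)
  refine mul_le_mul (Real.exp_le_exp.2 ?_) (inv_anti₀ (by positivity) ?_) ?_ (Real.exp_nonneg _)
  · calc ω * y ≤ |ω * y| := le_abs_self _
      _ = |ω| * |y| := abs_mul _ _
      _ ≤ _ := by gcongr
  · linarith [Real.one_add_sq_div_two_le_cosh (u R), Real.neg_one_le_cos y]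
  · exact inv_nonneg.2 (by linarith [Real.one_le_cosh (u R), Real.neg_one_le_cos y])

/-- Inside the strip `|Im z| < π`, the line of integration can be shifted to the real axis. -/
theorem integral_cexp_div_cosh_add_one_shift (ω : ℝ) {a : ℝ} (ha : |a| < π) :
    ∫ x : ℝ, cexp (-(I * ω * (x + a * I))) / (cosh (x + a * I) + 1) =
      ∫ x : ℝ, cexp (-(I * ω * x)) / (cosh x + 1) := by
  set f : ℂ → ℂ := fun z => cexp (-(I * ω * z)) / (cosh z + 1) with hf
  have hint (y : ℝ) (hy : |y| < π) := intervalIntegral_tendsto_integral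
    (integrable_cexp_div_cosh_add_one ω hy) tendsto_neg_atTop_atBot tendsto_id
  have h0 := hint 0 (by simpa using Real.pi_pos)
  have hsq : Tendsto (fun R : ℝ => R ^ 2) atTop atTop := tendsto_pow_atTop two_ne_zero
  have hr := tendsto_integral_vertical_cexp_div_cosh_add_one ω a (u := fun R => R) hsq
  have hl := tendsto_integral_vertical_cexp_div_cosh_add_one ω a (u := fun R => -R)
    (by simpa only [neg_sq] using hsq)
  have hrect (R : ℝ) := integral_boundary_rect_eq_zero_of_differentiableOn f
    (-R : ℝ) (R + a * I) fun z hz => by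
      have him : |z.im| ≤ |a| := by
        have := hz.2
        simp only [ofReal_im, add_im, mul_im, ofReal_re, I_im, I_re, Set.mem_preimage] at this
        simpa using Set.abs_sub_left_of_mem_uIcc this
      have hne : cosh z + 1 ≠ 0 := by
        rw [← re_add_im z]
        exact cosh_add_one_ne_zero (him.trans_lt ha)
      exact ((by fun_prop : DifferentiableAt ℂ (fun z => cexp (-(I * ω * z))) z).div
        (differentiableAt_cosh.add_const 1) hne).differentiableWithinAt
  have h := ((h0.sub (hint a ha)).add (hr.const_mul I)).sub (hl.const_mul I)
  have hz := tendsto_nhds_unique (h.congr fun R => by simpa [hf] using hrect R) tendsto_const_nhds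
  simp only [ofReal_zero, zero_mul, add_zero, mul_zero, sub_zero] at hz
  exact (sub_eq_zero.1 hz).symm

theorem Real.sigmoid_mul_one_sub_sigmoid (t : ℝ) :
    Real.sigmoid t * (1 - Real.sigmoid t) = (2 * (Real.cosh t + 1))⁻¹ := by
  rw [← Real.sigmoid_neg, Real.sigmoid_def, Real.sigmoid_def, ← mul_inv, Real.cosh_eq, neg_neg]
  congr 1
  have : Real.exp (-t) * Real.exp t = 1 := by rw [← Real.exp_add]; simp
  linear_combination this

/-- The substitution `x = sigmoid t` in the beta integral. -/
theorem betaIntegral_one_sub_one_add (s : ℂ) :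
    betaIntegral (1 - s) (1 + s) = ∫ t : ℝ, cexp (-(s * t)) / (2 * (cosh t + 1)) := by
  rw [betaIntegral, intervalIntegral.integral_of_le zero_le_one, integral_Ioc_eq_integral_Ioo,
    ← Real.range_sigmoid, ← Set.image_univ, integral_image_eq_integral_abs_deriv_smul
    MeasurableSet.univ (fun x _ => (Real.hasDerivAt_sigmoid x).hasDerivWithinAt)
    Real.sigmoid_injective.injOn, setIntegral_univ]
  refine integral_congr_ae (.of_forall fun t => ?_)
  have h0 := Real.sigmoid_pos t
  have h1 : 0 < 1 - Real.sigmoid t := sub_pos.2 (Real.sigmoid_lt_one t)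
  have hlog : Real.log (1 - Real.sigmoid t) = Real.log (Real.sigmoid t) - t := by
    rw [← Real.sigmoid_neg, ← Real.sigmoid_mul_rexp_neg, Real.log_mul h0.ne' (Real.exp_ne_zero _),
      Real.log_exp, sub_eq_add_neg]
  have hpow : (Real.sigmoid t : ℂ) ^ (1 - s - 1) * (1 - (Real.sigmoid t : ℂ)) ^ (1 + s - 1) =
      cexp (-(s * t)) := by
    have e : (1 : ℂ) - (Real.sigmoid t : ℂ) = ((1 - Real.sigmoid t : ℝ) : ℂ) := by push_cast; rfl
    rw [e, cpow_def_of_ne_zero (ofReal_ne_zero.2 h0.ne'), cpow_def_of_ne_zero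
      (ofReal_ne_zero.2 h1.ne'), ← ofReal_log h0.le, ← ofReal_log h1.le, hlog, ← Complex.exp_add]
    push_cast
    ring_nf
  simp only [hpow]
  rw [abs_of_pos (mul_pos h0 h1), Real.sigmoid_mul_one_sub_sigmoid, real_smul]
  push_cast
  rw [div_eq_mul_inv, mul_comm]

theorem integral_cexp_div_cosh_add_one {ω : ℝ} (hω : ω ≠ 0) :
    ∫ t : ℝ, cexp (-(I * ω * t)) / (cosh t + 1) = 2 * (π * ω / sinh (π * ω)) := by
  have h := betaIntegral_one_sub_one_add (I * ω)
  have hs : I * (ω : ℂ) ≠ 0 := mul_ne_zero I_ne_zero (ofReal_ne_zero.2 hω)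
  have hb := Gamma_mul_Gamma_eq_betaIntegral (s := 1 - I * ω) (t := 1 + I * ω)
    (by simp) (by simp)
  rw [show 1 - I * (ω : ℂ) + (1 + I * ω) = 1 + 1 by ring, Gamma_add_one 1 one_ne_zero,
    Gamma_one, one_mul, one_mul, add_comm 1 (I * (ω : ℂ)), Gamma_add_one _ hs, add_comm _ 1, h,
    mul_left_comm, mul_comm (Gamma _) (Gamma _), Gamma_mul_Gamma_one_sub] at hb
  have hsin : sin (π * (I * ω)) = sinh (π * ω) * I := by
    rw [← sin_mul_I]
    ring_nf
  simp_rw [mul_comm (2 : ℂ), ← div_div, integral_div] at hb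
  rw [hsin] at hb
  have hne : sinh ((π : ℂ) * ω) ≠ 0 := by
    rw [← ofReal_mul, ← ofReal_sinh, ofReal_ne_zero, Real.sinh_ne_zero]
    exact mul_ne_zero Real.pi_ne_zero hω
  rw [eq_div_iff two_ne_zero] at hb
  rw [← hb]
  field_simp

theorem hasDerivAt_sin_div_cosh_add_cos {a : ℝ} (ha : |a| < π) (t : ℝ) :
    HasDerivAt (fun t : ℝ => ((Real.sin a / (Real.cosh t + Real.cos a) : ℝ) : ℂ))
      ((1 / (cosh (t + a * I) + 1) - 1 / (cosh (t + (-a : ℝ) * I) + 1)) / (2 * I)) t := by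
  have hpos : Real.cosh t + Real.cos a ≠ 0 := by
    linarith [Real.one_le_cosh t, Real.neg_one_lt_cos_of_abs_lt_pi ha]
  have hd := (((Real.hasDerivAt_cosh t).add_const (Real.cos a)).fun_inv hpos).const_mul
    (Real.sin a)
  simp_rw [div_eq_mul_inv (Real.sin a)]
  convert hd.ofReal_comp using 1
  have h1 : cosh (t + a * I) + 1 ≠ 0 := cosh_add_one_ne_zero ha
  have h2 : cosh (t + (-a : ℝ) * I) + 1 ≠ 0 := cosh_add_one_ne_zero (by rwa [abs_neg])
  have hC : cosh (t : ℂ) + cos a ≠ 0 := by exact_mod_cast hpos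
  rw [cosh_add, cosh_mul_I, sinh_mul_I] at h1 h2
  rw [cosh_add, cosh_mul_I, sinh_mul_I, cosh_add, cosh_mul_I, sinh_mul_I]
  push_cast at h2 ⊢
  rw [cos_neg, sin_neg] at h2 ⊢
  have hprod : (cosh (t : ℂ) * cos a + sinh t * (sin a * I) + 1) *
      (cosh t * cos a + sinh t * (-sin a * I) + 1) = (cosh t + cos a) ^ 2 := by
    linear_combination (-sin (a : ℂ) ^ 2 * sinh (t : ℂ) ^ 2) * I_sq +
      (-sin (a : ℂ) ^ 2) * cosh_sq (t : ℂ) + (cosh (t : ℂ) ^ 2 - 1) * sin_sq_add_cos_sq (a : ℂ)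
  rw [div_sub_div _ _ h1 h2, hprod]
  field_simp
  ring

/-- The Fourier transform of `sin a / (cosh t + cos a)`: its derivative is a difference of two
imaginary translates of `1 / (cosh t + 1)`. -/
theorem integral_cexp_mul_sin_div_cosh_add_cos {ω a : ℝ} (hω : ω ≠ 0) (ha : |a| < π) :
    ∫ t : ℝ, cexp (-(I * ω * t)) * ((Real.sin a / (Real.cosh t + Real.cos a) : ℝ) : ℂ) =
      2 * π * sinh (ω * a) / sinh (π * ω) := by
  set K : ℝ → ℂ := fun t => ((Real.sin a / (Real.cosh t + Real.cos a) : ℝ) : ℂ)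
  set K' : ℝ → ℂ := fun t =>
    (1 / (cosh (t + a * I) + 1) - 1 / (cosh (t + (-a : ℝ) * I) + 1)) / (2 * I)
  set v : ℝ → ℂ := fun t => cexp (-(I * ω * t)) with hv_def
  have hv (t : ℝ) : HasDerivAt v (-(I * ω) * v t) t := by
    have h := (((hasDerivAt_id (t : ℂ)).const_mul (I * ω)).neg.cexp).comp_ofReal
    simpa [hv_def, mul_comm] using h
  have hna : |-a| < π := by rwa [abs_neg]
  have hKv : Integrable (K * v) := by
    have hK : Integrable K := by
      simp only [K, div_eq_mul_inv]
      exact ((Real.integrable_inv_cosh_add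
        (Real.neg_one_lt_cos_of_abs_lt_pi ha)).const_mul (Real.sin a)).ofReal
    have hvc : Continuous v := by fun_prop
    exact hK.mul_bdd (c := 1) hvc.aestronglyMeasurable (.of_forall fun t => by simp [v, norm_exp])
  have hG (b : ℝ) (t : ℝ) : 1 / (cosh (t + b * I) + 1) * v t =
      cexp (-(ω * b)) * (cexp (-(I * ω * (t + b * I))) / (cosh (t + b * I) + 1)) := by
    have e : v t = cexp (-(ω * b)) * cexp (-(I * ω * (t + b * I))) := by
      rw [← Complex.exp_add]
      refine congrArg cexp ?_
      linear_combination ((ω : ℂ) * b) * I_sq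
    rw [e, mul_div_assoc', div_mul_eq_mul_div, one_mul]
  have hK'v (t : ℝ) : (K' * v) t = (1 / (cosh (t + a * I) + 1) * v t -
      1 / (cosh (t + (-a : ℝ) * I) + 1) * v t) / (2 * I) := by
    simp only [K', Pi.mul_apply]
    ring
  have hint (b : ℝ) (hb : |b| < π) : Integrable fun t : ℝ => 1 / (cosh (t + b * I) + 1) * v t := by
    simp_rw [hG]
    exact (integrable_cexp_div_cosh_add_one ω hb).const_mul _
  have hval (b : ℝ) (hb : |b| < π) : ∫ t : ℝ, 1 / (cosh (t + b * I) + 1) * v t =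
      cexp (-(ω * b)) * (2 * (π * ω / sinh (π * ω))) := by
    simp_rw [hG, integral_const_mul, integral_cexp_div_cosh_add_one_shift ω hb,
      integral_cexp_div_cosh_add_one hω]
  have hparts := integral_mul_deriv_eq_deriv_mul_of_integrable (u := K) (v := v) (u' := K')
    (v' := fun t => -(I * ω) * v t) (fun t _ => hasDerivAt_sin_div_cosh_add_cos ha t)
    (fun t _ => hv t) (by simpa [mul_left_comm, Pi.mul_def] using hKv.const_mul (-(I * ω)))
    (by
      rw [funext hK'v]
      exact ((hint a ha).sub (hint (-a) hna)).div_const _) hKv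
  have hright : ∫ t, K' t * v t = I * ω * (2 * π * sinh (ω * a) / sinh (π * ω)) := by
    have := integral_congr_ae (μ := volume) (.of_forall hK'v)
    simp only [Pi.mul_apply] at this
    rw [this, integral_div, integral_sub (hint a ha) (hint (-a) hna), hval a ha, hval (-a) hna,
      sinh.eq_1 (ω * a)]
    push_cast
    field_simp
    rw [I_sq]
    ring
  rw [hright] at hparts
  simp_rw [mul_left_comm (K _), integral_const_mul] at hparts
  have hne : -(I * (ω : ℂ)) ≠ 0 := neg_ne_zero.2 (mul_ne_zero I_ne_zero (ofReal_ne_zero.2 hω))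
  change ∫ t, v t * K t = _
  simp_rw [mul_comm (v _)]
  refine mul_left_cancel₀ hne (hparts.trans ?_)
  ring

/-- Fourier-transform identity (Eq. (FY) of the paper): for `κ₁ > κ₂ > 0` and a nonzero
integer `n`,
`∫ e^{-ink} sin(πκ₂/κ₁) / (2κ₂ (cosh(πk/κ₁) + cos(πκ₂/κ₁))) dk
  = (κ₁/κ₂) sinh(nκ₂)/sinh(nκ₁)`. -/
theorem fourier_transform_Y_kernel (κ₁ κ₂ : ℝ) (h2 : 0 < κ₂) (h12 : κ₂ < κ₁)
    (n : ℤ) (hn : n ≠ 0) :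
    ∫ k : ℝ, Complex.exp (-(Complex.I * n * k)) *
        ((Real.sin (π * κ₂ / κ₁) /
          (2 * κ₂ * (Real.cosh (π * k / κ₁) + Real.cos (π * κ₂ / κ₁))) : ℝ) : ℂ)
      = ((κ₁ / κ₂ * (Real.sinh (n * κ₂) / Real.sinh (n * κ₁)) : ℝ) : ℂ) := by
  have h1 : 0 < κ₁ := h2.trans h12
  have h1' : (κ₁ : ℂ) ≠ 0 := ofReal_ne_zero.2 h1.ne'
  have ha : |π * κ₂ / κ₁| < π := by
    rw [abs_of_pos (by positivity), div_lt_iff₀ h1]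
    gcongr
  have hω : n * κ₁ / π ≠ 0 := by
    have : (n : ℝ) ≠ 0 := by exact_mod_cast hn
    positivity
  have h := integral_cexp_mul_sin_div_cosh_add_cos hω ha
  set G : ℝ → ℂ := fun t => cexp (-(I * (n * κ₁ / π : ℝ) * t)) *
    ((Real.sin (π * κ₂ / κ₁) / (Real.cosh t + Real.cos (π * κ₂ / κ₁)) : ℝ) : ℂ) with hG
  have hfun (k : ℝ) : cexp (-(I * n * k)) * ((Real.sin (π * κ₂ / κ₁) /
      (2 * κ₂ * (Real.cosh (π * k / κ₁) + Real.cos (π * κ₂ / κ₁))) : ℝ) : ℂ) =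
      (2 * κ₂ : ℂ)⁻¹ * G (π / κ₁ * k) := by
    have e : I * (n * κ₁ / π : ℝ) * (π / κ₁ * k : ℝ) = I * n * k := by
      push_cast
      field_simp
    simp only [hG]
    rw [e, div_mul_eq_mul_div, ← div_div, div_right_comm]
    push_cast
    ring
  simp_rw [hfun]
  rw [integral_const_mul, Measure.integral_comp_mul_left, h, abs_of_pos (by positivity), real_smul]
  have e1 : ((n * κ₁ / π : ℝ) : ℂ) * (π * κ₂ / κ₁ : ℝ) = n * κ₂ := by
    push_cast
    field_simp
  have e2 : (π : ℂ) * (n * κ₁ / π : ℝ) = n * κ₁ := by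
    push_cast
    field_simp
  rw [e1, e2]
  push_cast
  field_simp
end

section
/- Let L ≥ 1 be an integer and let f : ℤ × ℤ → ℝ satisfy: (i) f(j+L, j') = f(j, j') for all j, j' (periodicity in the first argument); (ii) f(j, 0) = 0 for all j; (iii) 4·f(j,j') = f(j+1,j') + f(j−1,j') + f(j,j'+1) + f(j,j'−1) for all j ∈ ℤ and all integers j' ≥ 1 (discrete harmonicity). Define M(j') := max_{0 ≤ j < L} f(j, j'). Then for every integer j' ≥ 1: M(j'+1) − M(j') ≥ M(j') − M(j'−1), and consequently M(j'+1)/(j'+1) ≥ M(j')/j'. -/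
theorem Function.Periodic.le_sup'_range {g : ℤ → ℝ} {L : ℕ} (hL : (Finset.range L).Nonempty)
    (hg : Function.Periodic g (L : ℤ)) (j : ℤ) :
    g j ≤ (Finset.range L).sup' hL (fun i => g (i : ℤ)) := by
  have hpos : (0 : ℤ) < L := by
    exact_mod_cast Nat.pos_of_ne_zero (Finset.nonempty_range_iff.mp hL)
  have hcast : ((j % L).toNat : ℤ) = j % L := Int.toNat_of_nonneg (Int.emod_nonneg j hpos.ne')
  have hlt : (j % L).toNat ∈ Finset.range L := by
    have := Int.emod_lt_of_pos j hpos
    rw [Finset.mem_range]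
    omega
  have heq : g j = g ((j % L).toNat : ℤ) := by
    have h := hg.int_mul (j / L) (j % L)
    rw [hcast, ← h]
    congr 1
    simpa [mul_comm] using (Int.emod_add_mul_ediv j L).symm
  rw [heq]
  exact Finset.le_sup' (fun i : ℕ => g (i : ℤ)) hlt

/-- A sequence that is convex from `0` on and vanishes at `0` is superlinear. -/
theorem add_one_mul_le_mul_of_convex_seq {M : ℤ → ℝ} (h0 : M 0 = 0)
    (hconv : ∀ n : ℤ, 1 ≤ n → M (n + 1) - M n ≥ M n - M (n - 1)) (n : ℤ) (hn : 1 ≤ n) :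
    ((n : ℝ) + 1) * M n ≤ n * M (n + 1) := by
  induction n, hn using Int.leInduction with
  | base =>
    have h := hconv 1 le_rfl
    norm_num [h0] at h ⊢
    linarith
  | succ n hn ih =>
    have h := hconv (n + 1) (by omega)
    rw [add_sub_cancel_right] at h
    have hpos : (0 : ℝ) ≤ n + 1 := by
      exact_mod_cast (by omega : (0 : ℤ) ≤ n + 1)
    have := mul_le_mul_of_nonneg_left h hpos
    push_cast
    linarith

/-- Discrete maximum-convexity lemma (Appendix A.3 of the paper): if `f : ℤ × ℤ → ℝ` is
`L`-periodic in the first argument, vanishes on the axis `j' = 0`, and is discretely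
harmonic for `j' ≥ 1`, then the row maxima `M(j') = max_{0 ≤ j < L} f(j,j')` form a
convex sequence, and consequently `M(j')/j'` is nondecreasing. -/
theorem discrete_harmonic_row_max_convex (L : ℕ) (hL : 1 ≤ L) (f : ℤ → ℤ → ℝ)
    (hper : ∀ j j' : ℤ, f (j + L) j' = f j j')
    (hzero : ∀ j : ℤ, f j 0 = 0)
    (hharm : ∀ j j' : ℤ, 1 ≤ j' →
      4 * f j j' = f (j + 1) j' + f (j - 1) j' + f j (j' + 1) + f j (j' - 1))
    (M : ℤ → ℝ)
    (hM : ∀ j' : ℤ, M j' =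
      (Finset.range L).sup' (Finset.nonempty_range_iff.mpr (Nat.one_le_iff_ne_zero.mp hL))
        (fun j => f (j : ℤ) j')) :
    ∀ j' : ℤ, 1 ≤ j' →
      (M (j' + 1) - M j' ≥ M j' - M (j' - 1)) ∧
      (M (j' + 1) / ((j' : ℝ) + 1) ≥ M j' / (j' : ℝ)) := by
  have hle (j j' : ℤ) : f j j' ≤ M j' := by
    rw [hM]
    exact Function.Periodic.le_sup'_range (g := fun i => f i j') _ (fun i => hper i j') j
  have hconv : ∀ n : ℤ, 1 ≤ n → M (n + 1) - M n ≥ M n - M (n - 1) := by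
    intro n hn
    obtain ⟨i, -, hi⟩ := Finset.exists_mem_eq_sup'
      (Finset.nonempty_range_iff.mpr (Nat.one_le_iff_ne_zero.mp hL)) (fun i : ℕ => f (i : ℤ) n)
    rw [← hM] at hi
    linarith [hharm i n hn, hle (i + 1) n, hle (i - 1) n, hle i (n + 1), hle i (n - 1)]
  have h0 : M 0 = 0 := by simp [hM, hzero]
  intro n hn
  refine ⟨hconv n hn, ?_⟩
  have hpos : (0 : ℝ) < n := by exact_mod_cast hn
  rw [ge_iff_le, div_le_div_iff₀ hpos (by linarith)]
  linarith [add_one_mul_le_mul_of_convex_seq h0 hconv n hn]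
end

section
/- Let B_1, …, B_m ∈ M_D(ℂ) and p_1, …, p_m ∈ {0,1}, and set A_j := σ_z^{p_j} ⊗ B_j ∈ M_{2D}(ℂ), where ⊗ is the Kronecker product, σ_x = [[0,1],[1,0]], σ_y = [[0,−i],[i,0]], σ_z = [[1,0],[0,−1]] are the Pauli matrices, σ⁰ = I₂, and σ_z⁰ = I₂. Define the linear maps E(X) := Σ_{j=1}^m A_j X A_j† on M_{2D}(ℂ) and E_±(ρ) := Σ_{j=1}^m (±1)^{p_j} B_j ρ B_j† on M_D(ℂ). Then for every ρ ∈ M_D(ℂ), w ∈ {0, x, y, z} and λ ∈ ℂ: if w ∈ {0, z} and E_+(ρ) = λρ then E(σ^w ⊗ ρ) = λ·(σ^w ⊗ ρ), and if w ∈ {x, y} and E_−(ρ) = λρ then E(σ^w ⊗ ρ) = λ·(σ^w ⊗ ρ). More generally, E maps each subspace σ^w ⊗ M_D(ℂ) into itself, acting on it as E_+ for w ∈ {0, z} and as E_− for w ∈ {x, y}; hence the spectrum of E is the union of the spectra of E_+ and E_−, each counted with doubled multiplicity. -/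
open scoped Kronecker Matrix

/-- If a linear equivalence onto a finite product intertwines `f` with the componentwise action
of a family `g`, then geometric multiplicities add up. -/
theorem finrank_eigenspace_eq_sum_of_intertwining {K V ι : Type*} {W : ι → Type*} [Field K]
    [Fintype ι] [AddCommGroup V] [Module K V] [∀ i, AddCommGroup (W i)] [∀ i, Module K (W i)]
    [∀ i, FiniteDimensional K (W i)] (e : V ≃ₗ[K] (∀ i, W i)) (f : Module.End K V)
    (g : ∀ i, Module.End K (W i)) (h : ∀ v i, e (f v) i = g i (e v i)) (μ : K) :
    Module.finrank K (f.eigenspace μ) = ∑ i, Module.finrank K ((g i).eigenspace μ) := by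
  have mem_iff (v : V) : v ∈ f.eigenspace μ ↔ ∀ i, e v i ∈ (g i).eigenspace μ := by
    simp only [Module.End.mem_eigenspace_iff]
    rw [← e.injective.eq_iff, map_smul, funext_iff]
    simp only [h, Pi.smul_apply]
  let blocks : f.eigenspace μ ≃ₗ[K] (∀ i, (g i).eigenspace μ) :=
    { toFun := fun v i => ⟨e v i, (mem_iff v).1 v.2 i⟩
      map_add' := fun v w => by ext i; simp
      map_smul' := fun c v => by ext i; simp
      invFun := fun w => ⟨e.symm fun i => w i, (mem_iff _).2 fun i => by simp⟩
      left_inv := fun v => by ext; simp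
      right_inv := fun w => by ext i; simp }
  rw [blocks.finrank_eq, Module.finrank_pi_fintype]

namespace Matrix

/-- A matrix indexed by pairs, viewed as the family of its blocks. -/
def prodBlocks (K ι n : Type*) [Semiring K] :
    Matrix (ι × n) (ι × n) K ≃ₗ[K] (ι × ι → Matrix n n K) where
  toFun X ab := X.submatrix (Prod.mk ab.1) (Prod.mk ab.2)
  map_add' _ _ := rfl
  map_smul' _ _ := rfl
  invFun Y := of fun x y => Y (x.1, y.1) x.2 y.2
  left_inv _ := rfl
  right_inv _ := rfl

theorem prodBlocks_apply {K ι n : Type*} [Semiring K] (X : Matrix (ι × n) (ι × n) K)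
    (ab : ι × ι) (i k : n) : prodBlocks K ι n X ab i k = X (ab.1, i) (ab.2, k) :=
  rfl

/-- Conjugation by a Kronecker product with a diagonal left factor acts blockwise. -/
theorem prodBlocks_diagonal_kronecker_conj {K ι n : Type*} [CommRing K] [StarRing K] [Fintype ι]
    [DecidableEq ι] [Fintype n] (d : ι → K) (B : Matrix n n K) (X : Matrix (ι × n) (ι × n) K)
    (ab : ι × ι) :
    prodBlocks K ι n ((diagonal d ⊗ₖ B) * X * (diagonal d ⊗ₖ B)ᴴ) ab =
      (d ab.1 * star (d ab.2)) • (B * prodBlocks K ι n X ab * Bᴴ) := by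
  ext i k
  simp only [prodBlocks_apply,
    mul_apply, Fintype.sum_prod_type, kroneckerMap_apply, conjTranspose_apply, diagonal_apply,
    smul_apply, smul_eq_mul, star_mul', apply_ite star, star_zero, ite_mul, mul_ite, zero_mul,
    mul_zero, Finset.sum_ite_irrel, Finset.sum_const_zero, Finset.sum_ite_eq, Finset.mem_univ,
    if_true, Finset.mul_sum, Finset.sum_mul]
  exact Finset.sum_congr rfl fun _ _ => Finset.sum_congr rfl fun _ _ => by ring

end Matrix

/-- Transfer-channel decomposition for fermionic SPT cat states (Sec. V.E of the paper).
With `A_j = σ_z^{p_j} ⊗ B_j`, the channel `E(X) = Σ_j A_j X A_j†` maps each subspace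
`σ^w ⊗ M_D(ℂ)` into itself, acting as the parity-even channel `E₊` for `w ∈ {0, z}` and
as the parity-twisted channel `E₋` for `w ∈ {x, y}`; in particular eigenvectors of `E₊`
(resp. `E₋`) yield eigenvectors `σ^w ⊗ ρ` of `E`, and every eigenvalue multiplicity of
`E` is twice the sum of the multiplicities for `E₊` and `E₋`. Here `σ 0 = I₂`,
`σ 1 = σ_x`, `σ 2 = σ_y`, `σ 3 = σ_z`. -/
theorem fermionic_transfer_channel_decomposition (D m : ℕ)
    (B : Fin m → Matrix (Fin D) (Fin D) ℂ) (p : Fin m → ℕ) (hp : ∀ j, p j = 0 ∨ p j = 1)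
    (σ : Fin 4 → Matrix (Fin 2) (Fin 2) ℂ)
    (hσ0 : σ 0 = 1) (hσ1 : σ 1 = !![0, 1; 1, 0])
    (hσ2 : σ 2 = !![0, -Complex.I; Complex.I, 0]) (hσ3 : σ 3 = !![1, 0; 0, -1])
    (A : Fin m → Matrix (Fin 2 × Fin D) (Fin 2 × Fin D) ℂ)
    (hA : ∀ j, A j = ((σ 3) ^ (p j)) ⊗ₖ B j)
    (E : Matrix (Fin 2 × Fin D) (Fin 2 × Fin D) ℂ →ₗ[ℂ]
         Matrix (Fin 2 × Fin D) (Fin 2 × Fin D) ℂ)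
    (hE : ∀ X, E X = ∑ j, A j * X * (A j)ᴴ)
    (Eplus Eminus : Matrix (Fin D) (Fin D) ℂ →ₗ[ℂ] Matrix (Fin D) (Fin D) ℂ)
    (hEplus : ∀ ρ, Eplus ρ = ∑ j, B j * ρ * (B j)ᴴ)
    (hEminus : ∀ ρ, Eminus ρ = ∑ j, ((-1 : ℂ) ^ (p j)) • (B j * ρ * (B j)ᴴ)) :
    (∀ (ρ : Matrix (Fin D) (Fin D) ℂ) (lam : ℂ) (w : Fin 4),
      ((w = 0 ∨ w = 3) → Eplus ρ = lam • ρ → E (σ w ⊗ₖ ρ) = lam • (σ w ⊗ₖ ρ)) ∧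
      ((w = 1 ∨ w = 2) → Eminus ρ = lam • ρ → E (σ w ⊗ₖ ρ) = lam • (σ w ⊗ₖ ρ))) ∧
    (∀ (ρ : Matrix (Fin D) (Fin D) ℂ) (w : Fin 4),
      ((w = 0 ∨ w = 3) → E (σ w ⊗ₖ ρ) = σ w ⊗ₖ Eplus ρ) ∧
      ((w = 1 ∨ w = 2) → E (σ w ⊗ₖ ρ) = σ w ⊗ₖ Eminus ρ)) ∧
    (∀ lam : ℂ,
      Module.finrank ℂ (Module.End.eigenspace E lam) =
        2 * Module.finrank ℂ (Module.End.eigenspace Eplus lam) +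
        2 * Module.finrank ℂ (Module.End.eigenspace Eminus lam)) := by
  have conj_even (j : Fin m) (w : Fin 4) (hw : w = 0 ∨ w = 3) :
      σ 3 ^ p j * σ w * (σ 3 ^ p j)ᴴ = σ w := by
    rcases hp j with h | h <;> rcases hw with rfl | rfl <;> ext a b <;>
      fin_cases a <;> fin_cases b <;>
      simp [h, hσ0, hσ3, Matrix.mul_apply, Fin.sum_univ_two]
  have conj_odd (j : Fin m) (w : Fin 4) (hw : w = 1 ∨ w = 2) :
      σ 3 ^ p j * σ w * (σ 3 ^ p j)ᴴ = (-1 : ℂ) ^ p j • σ w := by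
    rcases hp j with h | h <;> rcases hw with rfl | rfl <;> ext a b <;>
      fin_cases a <;> fin_cases b <;>
      simp [h, hσ1, hσ2, hσ3, Matrix.mul_apply, Fin.sum_univ_two]
  have E_kronecker (ρ : Matrix (Fin D) (Fin D) ℂ) (w : Fin 4) :
      E (σ w ⊗ₖ ρ) = ∑ j, (σ 3 ^ p j * σ w * (σ 3 ^ p j)ᴴ) ⊗ₖ (B j * ρ * (B j)ᴴ) := by
    simp only [hE, hA, Matrix.conjTranspose_kronecker, Matrix.mul_kronecker_mul]
  have kronecker_sum (M : Matrix (Fin 2) (Fin 2) ℂ) (N : Fin m → Matrix (Fin D) (Fin D) ℂ) :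
      M ⊗ₖ (∑ j, N j) = ∑ j, M ⊗ₖ N j := by
    ext
    simp [Matrix.sum_apply, Finset.mul_sum]
  have E_even (ρ : Matrix (Fin D) (Fin D) ℂ) (w : Fin 4) (hw : w = 0 ∨ w = 3) :
      E (σ w ⊗ₖ ρ) = σ w ⊗ₖ Eplus ρ := by
    simp only [E_kronecker, conj_even _ w hw, hEplus, kronecker_sum]
  have E_odd (ρ : Matrix (Fin D) (Fin D) ℂ) (w : Fin 4) (hw : w = 1 ∨ w = 2) :
      E (σ w ⊗ₖ ρ) = σ w ⊗ₖ Eminus ρ := by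
    simp only [E_kronecker, conj_odd _ w hw, hEminus, kronecker_sum, Matrix.smul_kronecker,
      Matrix.kronecker_smul]
  refine ⟨fun ρ lam w => ⟨fun hw h => ?_, fun hw h => ?_⟩,
    fun ρ w => ⟨E_even ρ w, E_odd ρ w⟩, fun lam => ?_⟩
  · rw [E_even ρ w hw, h, Matrix.kronecker_smul]
  · rw [E_odd ρ w hw, h, Matrix.kronecker_smul]
  have σ3_diagonal : σ 3 = Matrix.diagonal ![1, -1] := by
    rw [hσ3]
    ext a b
    fin_cases a <;> fin_cases b <;> simp
  have E_blocks (X : Matrix (Fin 2 × Fin D) (Fin 2 × Fin D) ℂ) (ab : Fin 2 × Fin 2) :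
      Matrix.prodBlocks ℂ (Fin 2) (Fin D) (E X) ab =
        (if ab.1 = ab.2 then Eplus else Eminus) (Matrix.prodBlocks ℂ (Fin 2) (Fin D) X ab) := by
    simp only [hE, hA, σ3_diagonal, Matrix.diagonal_pow, map_sum, Finset.sum_apply,
      Matrix.prodBlocks_diagonal_kronecker_conj]
    obtain ⟨a, b⟩ := ab
    fin_cases a <;> fin_cases b <;> simp [hEplus, hEminus, ← mul_pow]
  rw [finrank_eigenspace_eq_sum_of_intertwining (Matrix.prodBlocks ℂ (Fin 2) (Fin D)) E
    (fun ab => if ab.1 = ab.2 then Eplus else Eminus) E_blocks]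
  simp only [Fintype.sum_prod_type, Fin.sum_univ_two]
  change Module.finrank ℂ (Module.End.eigenspace Eplus lam) +
      Module.finrank ℂ (Module.End.eigenspace Eminus lam) +
    (Module.finrank ℂ (Module.End.eigenspace Eminus lam) +
      Module.finrank ℂ (Module.End.eigenspace Eplus lam)) = _
  ring
end
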